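/- Let (l₁, l₂, l₃) ∈ ℝ³ satisfy lᵢ > 0 and lᵢ + lⱼ > l_k for every permutation (i,j,k) of (1,2,3), and let θᵢ = arccos((lⱼ² + l_k² − lᵢ²)/(2·lⱼ·l_k)) be the inner angles of the corresponding Euclidean triangle. Define the Gram matrix G ∈ M₃(ℝ) by Gᵢᵢ = 1 and Gᵢⱼ = −cos(θ_k) for i ≠ j, where {i,j,k} = {1,2,3}. Then G is positive semidefinite, and for v ∈ ℝ³ one has G·v = 0 if and only if v is a scalar multiple of the edge-length vector (l₁, l₂, l₃); in particular G has rank 2. -/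

import Mathlib

open Real

/-- The inner angle of a Euclidean triangle opposite the `i`-th edge, as a function of the
edge lengths `l : Fin 3 → ℝ`. -/
noncomputable def triAngle (l : Fin 3 → ℝ) (i : Fin 3) : ℝ :=
  Real.arccos (((l (i + 1)) ^ 2 + (l (i + 2)) ^ 2 - (l i) ^ 2) / (2 * l (i + 1) * l (i + 2)))

/-- The law of cosines quotient at a vertex of a nondegenerate triangle lies in `(-1, 1)`. -/
lemma abs_law_of_cosines_quotient_lt_one {a b c : ℝ} (hb : 0 < b) (hc : 0 < c)
    (h₁ : a < b + c) (h₂ : b < c + a) (h₃ : c < a + b) :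
    |(b ^ 2 + c ^ 2 - a ^ 2) / (2 * b * c)| < 1 := by
  rw [abs_lt, lt_div_iff₀ (by positivity), div_lt_one (by positivity)]
  constructor
  · nlinarith [mul_pos (sub_pos.2 h₁) (by linarith : 0 < a + b + c)]
  · nlinarith [mul_pos (sub_pos.2 h₂) (sub_pos.2 h₃)]

/-- The cosine of the angle of a Euclidean triangle is given by the law of cosines, and the
angle is nondegenerate. -/
lemma cos_triAngle {l : Fin 3 → ℝ} (hpos : ∀ i, 0 < l i)
    (htri : ∀ i : Fin 3, l i < l (i + 1) + l (i + 2)) (i : Fin 3) :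
    cos (triAngle l i) =
        (l (i + 1) ^ 2 + l (i + 2) ^ 2 - l i ^ 2) / (2 * l (i + 1) * l (i + 2)) ∧
      |cos (triAngle l i)| < 1 := by
  have h₂ := htri (i + 1)
  have h₃ := htri (i + 2)
  rw [show i + 1 + 1 = i + 2 by grind, show i + 1 + 2 = i by grind] at h₂
  rw [show i + 2 + 1 = i by grind, show i + 2 + 2 = i + 1 by grind] at h₃
  have h := abs_law_of_cosines_quotient_lt_one (hpos (i + 1)) (hpos (i + 2)) (htri i) h₂ h₃
  have hcos := cos_arccos (abs_lt.1 h).1.le (abs_lt.1 h).2.le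
  exact ⟨hcos, by rwa [triAngle, hcos]⟩

/-- The projection formula: each edge of a triangle is the sum of the projections onto it of the
other two edges. -/
lemma edge_eq_add_mul_cos_triAngle {l : Fin 3 → ℝ} (hpos : ∀ i, 0 < l i)
    (htri : ∀ i : Fin 3, l i < l (i + 1) + l (i + 2)) (i : Fin 3) :
    l i = cos (triAngle l (i + 2)) * l (i + 1) + cos (triAngle l (i + 1)) * l (i + 2) := by
  rw [(cos_triAngle hpos htri _).1, (cos_triAngle hpos htri _).1,
    show i + 1 + 1 = i + 2 by grind, show i + 1 + 2 = i by grind,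
    show i + 2 + 1 = i by grind, show i + 2 + 2 = i + 1 by grind]
  have h₀ := (hpos i).ne'
  have h₁ := (hpos (i + 1)).ne'
  have h₂ := (hpos (i + 2)).ne'
  field_simp
  ring

/-- If the kernel of a real matrix is the line spanned by a nonzero vector, then its rank is one
less than its number of columns. -/
lemma Matrix.rank_add_one_of_mulVec_eq_zero_iff {m n : Type*} [Fintype m] [Fintype n]
    {A : Matrix m n ℝ} {w : n → ℝ} (hw : w ≠ 0)
    (h : ∀ v, A.mulVec v = 0 ↔ ∃ c : ℝ, v = c • w) : A.rank + 1 = Fintype.card n := by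
  have hker : LinearMap.ker A.mulVecLin = Submodule.span ℝ {w} := by
    ext v
    simp [h, Submodule.mem_span_singleton, eq_comm]
  have := LinearMap.finrank_range_add_finrank_ker A.mulVecLin
  rwa [hker, finrank_span_singleton hw, Module.finrank_fintype_fun_eq_card] at this

/-- The angle Gram matrix of a Euclidean triangle (with `Gᵢᵢ = 1`, `Gᵢⱼ = -cos θ_k` for
`i ≠ j`) is positive semidefinite, its null space is spanned by the edge length vector,
and it has rank 2. -/
theorem gram_matrix_euclidean_triangle
    (l : Fin 3 → ℝ) (hpos : ∀ i, 0 < l i) (htri : ∀ i : Fin 3, l i < l (i + 1) + l (i + 2))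
    (G : Matrix (Fin 3) (Fin 3) ℝ)
    (hG : ∀ i j : Fin 3, G i j = if i = j then 1 else -Real.cos (triAngle l (-(i + j)))) :
    G.PosSemidef ∧
    (∀ v : Fin 3 → ℝ, G.mulVec v = 0 ↔ ∃ c : ℝ, v = c • l) ∧
    G.rank = 2 := by
  have hr := (cos_triAngle hpos htri 2).2
  have e₀ := edge_eq_add_mul_cos_triAngle hpos htri 0
  have e₁ := edge_eq_add_mul_cos_triAngle hpos htri 1
  have e₂ := edge_eq_add_mul_cos_triAngle hpos htri 2
  simp only [Fin.isValue, zero_add, show (1 : Fin 3) + 1 = 2 from rfl,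
    show (1 : Fin 3) + 2 = 0 from rfl, show (2 : Fin 3) + 1 = 0 from rfl,
    show (2 : Fin 3) + 2 = 1 from rfl] at e₀ e₁ e₂
  have hG' : G = !![1, -cos (triAngle l 2), -cos (triAngle l 1);
      -cos (triAngle l 2), 1, -cos (triAngle l 0);
      -cos (triAngle l 1), -cos (triAngle l 0), 1] := by
    ext i j
    rw [hG]
    fin_cases i <;> fin_cases j <;> rfl
  clear hG
  generalize cos (triAngle l 0) = p at *
  generalize cos (triAngle l 1) = q at *
  generalize cos (triAngle l 2) = r at *
  have hr' : 0 < 1 - r ^ 2 := sub_pos.2 ((sq_lt_one_iff_abs_lt_one r).2 hr)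
  have hc := hpos 2
  have k₁ : (1 - r ^ 2) * l 1 = (r * q + p) * l 2 := by linear_combination e₁ + r * e₀
  have k₂ : (1 - q ^ 2) * l 2 = (r * q + p) * l 1 := by linear_combination e₂ + q * e₀
  have hker : ∀ v : Fin 3 → ℝ, G.mulVec v = 0 ↔ ∃ c : ℝ, v = c • l := by
    intro v
    simp only [hG', funext_iff, Fin.forall_fin_succ, Matrix.mulVec, dotProduct,
      Fin.sum_univ_three, Pi.smul_apply, smul_eq_mul]
    simp
    constructor
    · rintro ⟨f₀, f₁, -⟩
      have h₁ : l 2 * v 1 = l 1 * v 2 :=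
        mul_left_cancel₀ hr'.ne' (by linear_combination l 2 * f₁ + l 2 * r * f₀ - v 2 * k₁)
      refine ⟨v 2 / l 2, ?_, ?_, ?_⟩
      · field_simp
        linear_combination l 2 * f₀ + r * h₁ - v 2 * e₀
      · field_simp
        linear_combination h₁
      · field_simp
    · rintro ⟨c, h₀, h₁, h₂⟩
      rw [h₀, h₁, h₂]
      refine ⟨?_, ?_, ?_⟩
      · linear_combination c * e₀
      · linear_combination c * e₁
      · linear_combination c * e₂
  refine ⟨.of_dotProduct_mulVec_nonneg ?_ fun v => ?_, hker, ?_⟩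
  · rw [hG']
    ext i j
    fin_cases i <;> fin_cases j <;> simp
  · refine nonneg_of_mul_nonneg_right (a := l 2 ^ 2) ?_ (by positivity)
    have hsq : l 2 ^ 2 * (star v ⬝ᵥ G.mulVec v) =
        l 2 ^ 2 * (v 0 - r * v 1 - q * v 2) ^ 2 + (1 - r ^ 2) * (l 2 * v 1 - l 1 * v 2) ^ 2 := by
      simp [hG', Matrix.mulVec, dotProduct, Fin.sum_univ_three]
      linear_combination (2 * l 2 * v 1 * v 2 - l 1 * v 2 ^ 2) * k₁ + l 2 * v 2 ^ 2 * k₂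
    rw [hsq]
    positivity
  · have hl : l ≠ 0 := fun h => hc.ne' (congrFun h 2)
    simpa using Matrix.rank_add_one_of_mulVec_eq_zero_iff hl hker
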